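/- Let λ_1, …, λ_n be pairwise distinct real numbers and let 1 ≤ i ≤ n−1. Then ∏_{m=i}^{n−1} 1/(λ_n − λ_m) + ∑_{j=i}^{n−1} (∏_{p=i}^{j−1} 1/(λ_j − λ_p)) · (∏_{q=j+1}^{n} 1/(λ_j − λ_q)) = 0. -/

import Mathlib

/-- The nodal weights of at least two distinct nodes sum to zero. -/
theorem Lagrange.sum_nodalWeight_eq_zero {F ι : Type*} [Field F] [DecidableEq ι] {s : Finset ι}
    {v : ι → F} (hvs : Set.InjOn v s) (hs : 1 < s.card) :
    ∑ j ∈ s, Lagrange.nodalWeight s v j = 0 := by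
  have h := Lagrange.coeff_eq_sum hvs (P := 1)
    (by rw [Polynomial.degree_one]; exact_mod_cast (by lia : 0 < s.card))
  rw [Polynomial.coeff_one, if_neg (by lia)] at h
  simpa [Lagrange.nodalWeight, Finset.prod_inv_distrib] using h.symm

theorem stmt17 (n i : ℕ) (hi1 : 1 ≤ i) (hi2 : i ≤ n - 1)
    (lam : ℕ → ℝ) (hinj : Set.InjOn lam (Set.Icc 1 n)) :
    (∏ m ∈ Finset.Icc i (n - 1), (lam n - lam m)⁻¹) +
      ∑ j ∈ Finset.Icc i (n - 1),
        (∏ p ∈ Finset.Icc i (j - 1), (lam j - lam p)⁻¹) *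
          ∏ q ∈ Finset.Icc (j + 1) n, (lam j - lam q)⁻¹ = 0 := by
  have h := Lagrange.sum_nodalWeight_eq_zero (s := Finset.Icc i n) (v := lam)
    (hinj.mono (by rw [Finset.coe_Icc]; exact Set.Icc_subset_Icc_left hi1))
    (by rw [Nat.card_Icc]; lia)
  have hn : Finset.Icc i n = insert n (Finset.Icc i (n - 1)) := by ext; simp; lia
  have hn' : n ∉ Finset.Icc i (n - 1) := by simp; lia
  have hsum := Finset.sum_insert (f := Lagrange.nodalWeight (Finset.Icc i n) lam) hn'
  rw [← hn, h] at hsum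
  rw [hsum]
  congr 1
  · rw [Lagrange.nodalWeight, hn, Finset.erase_insert hn']
  · refine Finset.sum_congr rfl fun j hj => ?_
    rw [Finset.mem_Icc] at hj
    have hj' : (Finset.Icc i n).erase j = Finset.Icc i (j - 1) ∪ Finset.Icc (j + 1) n := by
      ext; simp; lia
    rw [Lagrange.nodalWeight, hj', Finset.prod_union]
    rw [Finset.disjoint_left]
    intro a
    simp
    lia
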